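/- If f : SG → ℝ is continuous and of bounded variation in the sense (A), then 0 < H^s(G_f) < ∞ where s = log 3/log 2 and G_f ⊂ ℝ³ is the graph of f; in particular dim_H(G_f) = log 3/log 2. -/

import Mathlib

open Set Metric MeasureTheory Filter ENNReal

noncomputable section

/-- The three vertices of the equilateral triangle generating the Sierpinski gasket. -/
def q : Fin 3 → ℝ × ℝ := ![(0,0), (1,0), (1/2, Real.sqrt 3 / 2)]

/-- The contraction maps of the IFS: `u i x = (x + q i)/2`. -/
def u (i : Fin 3) (x : ℝ × ℝ) : ℝ × ℝ := (2⁻¹ : ℝ) • (x + q i)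

/-- The address map of the IFS. -/
def addr (σ : ℕ → Fin 3) : ℝ × ℝ := ∑' n, ((2:ℝ)⁻¹ ^ (n+1)) • q (σ n)

/-- The Sierpinski gasket, as the set of points with an address. -/
def SG : Set (ℝ × ℝ) := Set.range addr

/-- Composition `u_{w₁} ∘ ⋯ ∘ u_{w_n}` along a word `w`. -/
def uw : List (Fin 3) → (ℝ × ℝ) → (ℝ × ℝ)
  | [] => id
  | i :: w => u i ∘ uw w

/-- The level-`n` cell of `SG` indexed by a word `w ∈ {1,2,3}^n`. -/
def cell {n : ℕ} (w : Fin n → Fin 3) : Set (ℝ × ℝ) := uw (List.ofFn w) '' SG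

/-- Oscillation (maximum range) `R_f[X]` of `f` over `X`, valued in `ℝ≥0∞`. -/
def osc (f : ℝ × ℝ → ℝ) (X : Set (ℝ × ℝ)) : ℝ≥0∞ :=
  ⨆ x ∈ X, ⨆ y ∈ X, ENNReal.ofReal |f x - f y|

/-- Total oscillation of order `n`: `R(n,f) = Σ_{w ∈ {1,2,3}^n} R_f[u_w(SG)]`. -/
def oscSum (n : ℕ) (f : ℝ × ℝ → ℝ) : ℝ≥0∞ :=
  ∑ w : Fin n → Fin 3, osc f (cell w)

/-- Total variation in the sense of definition (A). -/
def VA (f : ℝ × ℝ → ℝ) : ℝ≥0∞ := ⨆ n : ℕ, oscSum n f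

/-- Bounded variation in the sense of definition (A). -/
def BVA (f : ℝ × ℝ → ℝ) : Prop := VA f < ⊤

/-- `s = log 3 / log 2`, the dimension of `SG`. -/
def sdim : ℝ := Real.log 3 / Real.log 2

/-- Total oscillation of order `n` with exponent `s`. -/
def oscSumS (n : ℕ) (f : ℝ × ℝ → ℝ) : ℝ≥0∞ :=
  ∑ w : Fin n → Fin 3, (osc f (cell w)) ^ sdim

/-- Total variation in the sense of definition (A*). -/
def VAs (f : ℝ × ℝ → ℝ) : ℝ≥0∞ := ⨆ n : ℕ, oscSumS n f

/-- Bounded variation in the sense of definition (A*). -/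
def BVAs (f : ℝ × ℝ → ℝ) : Prop := VAs f < ⊤

/-- The graph `G_f = {(t, f t) : t ∈ SG} ⊂ ℝ³`. -/
def graphSG (f : ℝ × ℝ → ℝ) : Set ((ℝ × ℝ) × ℝ) := (fun t => (t, f t)) '' SG

/-- Smallest number of sets of diameter at most `δ` needed to cover `F`. -/
def coverNum {X : Type*} [MetricSpace X] (F : Set X) (δ : ℝ) : ℕ :=
  sInf {n : ℕ | ∃ t : Finset (Set X), t.card = n ∧ F ⊆ ⋃₀ ↑t ∧ ∀ U ∈ t, Metric.diam U ≤ δ}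

/-- Upper box (Minkowski) dimension. -/
def upperBoxDim {X : Type*} [MetricSpace X] (F : Set X) : ℝ :=
  Filter.limsup (fun δ : ℝ => Real.log (coverNum F δ) / (-Real.log δ)) (nhdsWithin 0 (Set.Ioi 0))

/-- Lower box dimension. -/
def lowerBoxDim {X : Type*} [MetricSpace X] (F : Set X) : ℝ :=
  Filter.liminf (fun δ : ℝ => Real.log (coverNum F δ) / (-Real.log δ)) (nhdsWithin 0 (Set.Ioi 0))

/-- The Euclidean norm on `ℝ × ℝ`. -/
def enorm2 (x : ℝ × ℝ) : ℝ := Real.sqrt (x.1 ^ 2 + x.2 ^ 2)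

lemma aux_norm_q (i : Fin 3) : ‖q i‖ ≤ 1 := by
  have h3 : Real.sqrt 3 ≤ 2 := by
    rw [Real.sqrt_le_left (by norm_num)]; norm_num
  have h0 := Real.sqrt_nonneg 3
  fin_cases i
  · simp [q]
  · simp [q, Prod.norm_def]
  · simp only [q, Prod.norm_def]
    simp [abs_of_nonneg h0]
    constructor
    · norm_num
    · linarith

lemma aux_hasSum : HasSum (fun n : ℕ => (2:ℝ)⁻¹ ^ (n+1)) 1 := by
  have h := (hasSum_geometric_of_lt_one (r := (2:ℝ)⁻¹) (by norm_num) (by norm_num)).mul_left (2:ℝ)⁻¹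
  have e : (2:ℝ)⁻¹ * (1 - (2:ℝ)⁻¹)⁻¹ = 1 := by norm_num
  rw [e] at h
  simpa only [pow_succ'] using h

lemma aux_term (σ : ℕ → Fin 3) (n : ℕ) :
    ‖((2:ℝ)⁻¹ ^ (n+1)) • q (σ n)‖ ≤ (2:ℝ)⁻¹ ^ (n+1) := by
  rw [norm_smul, Real.norm_of_nonneg (by positivity)]
  exact mul_le_of_le_one_right (by positivity) (aux_norm_q _)

lemma aux_norm_addr (σ : ℕ → Fin 3) : ‖addr σ‖ ≤ 1 :=
  tsum_of_norm_bounded aux_hasSum (aux_term σ)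

lemma aux_summable (σ : ℕ → Fin 3) : Summable (fun n : ℕ => ((2:ℝ)⁻¹ ^ (n+1)) • q (σ n)) :=
  Summable.of_norm_bounded aux_hasSum.summable (aux_term σ)

lemma aux_addr_continuous : Continuous addr := by
  refine continuous_tsum (fun n => ?_) aux_hasSum.summable (fun n σ => aux_term σ n)
  have : Continuous (fun σ : ℕ → Fin 3 => q (σ n)) :=
    (continuous_of_discreteTopology (f := q)).comp (continuous_apply n)
  exact this.const_smul ((2:ℝ)⁻¹ ^ (n+1))

lemma aux_SG_compact : IsCompact SG := isCompact_range aux_addr_continuous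

lemma aux_addr_shift (σ : ℕ → Fin 3) : addr σ = u (σ 0) (addr (fun k => σ (k+1))) := by
  unfold addr u
  rw [(aux_summable σ).tsum_eq_zero_add, smul_add, ← tsum_const_smul'']
  rw [add_comm]
  congr 1
  · congr 1
    funext n
    rw [smul_smul, ← pow_succ']
  · simp

lemma aux_addr_shift' (σ : ℕ → Fin 3) (n : ℕ) :
    addr (fun k => σ (k+n)) = u (σ n) (addr (fun k => σ (k+(n+1)))) := by
  rw [aux_addr_shift]
  simp only [zero_add]
  congr 2
  funext k
  congr 1
  ring

/-- Integer lattice coordinates of the level `n` cell. -/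
def auxA (j : Fin 3) (σ : ℕ → Fin 3) : ℕ → ℤ
  | 0 => 0
  | n+1 => 2 * auxA j σ n + if σ n = j then 1 else 0

lemma aux_inj (σ τ : ℕ → Fin 3) (n : ℕ) (h1 : auxA 1 σ n = auxA 1 τ n)
    (h2 : auxA 2 σ n = auxA 2 τ n) : ∀ k < n, σ k = τ k := by
  induction n with
  | zero => intro k hk; omega
  | succ n ih =>
    simp only [auxA] at h1 h2
    have e1 : auxA 1 σ n = auxA 1 τ n := by split_ifs at h1 <;> omega
    have e2 : auxA 2 σ n = auxA 2 τ n := by split_ifs at h2 <;> omega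
    have hn : σ n = τ n := by
      rw [e1] at h1
      rw [e2] at h2
      generalize σ n = a at *
      generalize τ n = b at *
      fin_cases a <;> fin_cases b <;> simp_all
    intro k hk
    rcases Nat.lt_succ_iff_lt_or_eq.mp hk with h | h
    · exact ih e1 e2 k h
    · rw [h]; exact hn

lemma aux_unroll (σ : ℕ → Fin 3) (n : ℕ) :
    (2:ℝ)^n • addr σ = ((auxA 1 σ n : ℝ) • q 1 + (auxA 2 σ n : ℝ) • q 2)
      + addr (fun k => σ (k+n)) := by
  induction n with
  | zero => simp [auxA]
  | succ n ih =>
    rw [pow_succ', mul_smul, ih, aux_addr_shift' σ n]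
    generalize addr (fun k => σ (k+(n+1))) = z
    simp only [auxA, u]
    generalize σ n = a
    have hq : q 0 = 0 := rfl
    push_cast
    fin_cases a <;> simp [hq] <;> module

lemma aux_close (σ τ : ℕ → Fin 3) (n : ℕ) (h : dist (addr σ) (addr τ) ≤ (2:ℝ)⁻¹^n) :
    |auxA 1 σ n - auxA 1 τ n| ≤ 5 ∧ |auxA 2 σ n - auxA 2 τ n| ≤ 5 := by
  have e : ((auxA 1 σ n - auxA 1 τ n : ℤ) : ℝ) • q 1 + ((auxA 2 σ n - auxA 2 τ n : ℤ) : ℝ) • q 2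
      = (2:ℝ)^n • (addr σ - addr τ) - addr (fun k => σ (k+n)) + addr (fun k => τ (k+n)) := by
    rw [smul_sub, aux_unroll, aux_unroll]
    push_cast
    module
  generalize (auxA 1 σ n - auxA 1 τ n) = a at *
  generalize (auxA 2 σ n - auxA 2 τ n) = b at *
  have hn : ‖(a:ℝ) • q 1 + (b:ℝ) • q 2‖ ≤ 3 := by
    rw [e]
    have h1 : ‖(2:ℝ)^n • (addr σ - addr τ)‖ ≤ 1 := by
      rw [norm_smul, Real.norm_of_nonneg (by positivity), ← dist_eq_norm]
      calc _ ≤ (2:ℝ)^n * (2:ℝ)⁻¹^n := by gcongr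
        _ = 1 := by rw [← mul_pow]; norm_num
    have h2 := norm_add_le ((2:ℝ)^n • (addr σ - addr τ) - addr (fun k => σ (k+n)))
      (addr (fun k => τ (k+n)))
    have h3 := norm_sub_le ((2:ℝ)^n • (addr σ - addr τ)) (addr (fun k => σ (k+n)))
    have h4 := aux_norm_addr (fun k => σ (k+n))
    have h5 := aux_norm_addr (fun k => τ (k+n))
    linarith
  have hx := (norm_fst_le _).trans hn
  have hy := (norm_snd_le _).trans hn
  simp [q] at hx hy
  have h3 : (3/2 : ℝ) ≤ Real.sqrt 3 := by
    apply Real.le_sqrt_of_sq_le; norm_num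
  rw [abs_le] at hx
  rw [abs_of_nonneg (Real.sqrt_nonneg 3)] at hy
  have hb : |(b:ℝ)| ≤ 4 := by nlinarith [abs_nonneg (b:ℝ)]
  rw [abs_le] at hb
  have ha1 : (-5:ℝ) ≤ a := by linarith
  have ha2 : (a:ℝ) ≤ 5 := by linarith
  have hb1 : (-4:ℝ) ≤ b := hb.1
  have hb2 : (b:ℝ) ≤ 4 := hb.2
  have ha1' : -5 ≤ a := by exact_mod_cast ha1
  have ha2' : a ≤ 5 := by exact_mod_cast ha2
  have hb1' : -4 ≤ b := by exact_mod_cast hb1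
  have hb2' : b ≤ 4 := by exact_mod_cast hb2
  constructor <;> rw [abs_le] <;> constructor <;> omega

/-- Uniform product measure on addresses. -/
def auxP : Measure (ℕ → Fin 3) :=
  Measure.infinitePi (fun _ : ℕ => (PMF.uniformOfFintype (Fin 3)).toMeasure)

instance : IsProbabilityMeasure auxP := by unfold auxP; infer_instance

lemma aux_cyl (τ : ℕ → Fin 3) (n : ℕ) : auxP {σ | ∀ k < n, σ k = τ k} = (3:ℝ≥0∞)⁻¹ ^ n := by
  have : {σ : ℕ → Fin 3 | ∀ k < n, σ k = τ k}
      = Set.pi (Finset.range n : Set ℕ) (fun k => {τ k}) := by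
    ext σ; simp [Set.mem_pi]
  rw [this, auxP, Measure.infinitePi_pi _ (fun i _ => measurableSet_singleton _)]
  simp

lemma aux_slice (n : ℕ) (a b : ℤ) :
    auxP {σ | auxA 1 σ n = a ∧ auxA 2 σ n = b} ≤ (3:ℝ≥0∞)⁻¹ ^ n := by
  rcases Set.eq_empty_or_nonempty {σ | auxA 1 σ n = a ∧ auxA 2 σ n = b} with h | ⟨τ, h1, h2⟩
  · rw [h]; simp
  · rw [← aux_cyl τ n]
    apply measure_mono
    rintro σ ⟨g1, g2⟩
    exact aux_inj σ τ n (g1.trans h1.symm) (g2.trans h2.symm)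

lemma aux_mass (U : Set (ℝ × ℝ)) (n : ℕ) (hU : ediam U ≤ ENNReal.ofReal ((2:ℝ)⁻¹^n)) :
    auxP (addr ⁻¹' U) ≤ 121 * (3:ℝ≥0∞)⁻¹ ^ n := by
  rcases Set.eq_empty_or_nonempty (addr ⁻¹' U) with h | ⟨τ, hτ⟩
  · rw [h]; simp
  have hsub : addr ⁻¹' U ⊆ ⋃ p ∈ (Finset.Icc (-5:ℤ) 5 ×ˢ Finset.Icc (-5:ℤ) 5),
      {σ | auxA 1 σ n = auxA 1 τ n + p.1 ∧ auxA 2 σ n = auxA 2 τ n + p.2} := by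
    intro σ hσ
    have hd : dist (addr σ) (addr τ) ≤ (2:ℝ)⁻¹^n := by
      have := (edist_le_ediam_of_mem (s := U) (x := addr σ) (y := addr τ) hσ hτ).trans hU
      rwa [edist_dist, ENNReal.ofReal_le_ofReal_iff (by positivity)] at this
    obtain ⟨h1, h2⟩ := aux_close σ τ n hd
    rw [abs_le] at h1 h2
    simp only [Set.mem_iUnion]
    refine ⟨(auxA 1 σ n - auxA 1 τ n, auxA 2 σ n - auxA 2 τ n), ?_, ?_⟩
    · simp only [Finset.mem_product, Finset.mem_Icc]
      omega
    · constructor <;> simp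
  calc _ ≤ _ := measure_mono hsub
    _ ≤ _ := measure_biUnion_finset_le _ _
    _ ≤ ∑ p ∈ (Finset.Icc (-5:ℤ) 5 ×ˢ Finset.Icc (-5:ℤ) 5), (3:ℝ≥0∞)⁻¹ ^ n :=
        Finset.sum_le_sum (fun p _ => aux_slice n _ _)
    _ = _ := by
      rw [Finset.sum_const, nsmul_eq_mul]
      simp

lemma aux_sdim_gt : 1 < sdim := by
  unfold sdim
  rw [one_lt_div (Real.log_pos (by norm_num))]
  exact Real.log_lt_log (by norm_num) (by norm_num)

lemma aux_two_rpow : (2:ℝ) ^ sdim = 3 := by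
  rw [Real.rpow_def_of_pos (by norm_num), sdim,
    mul_div_cancel₀ _ (Real.log_pos (by norm_num)).ne', Real.exp_log (by norm_num)]

lemma aux_two_rpow' (n : ℕ) :
    (ENNReal.ofReal ((2:ℝ)⁻¹ ^ n)) ^ sdim = (3:ℝ≥0∞)⁻¹ ^ n := by
  rw [ENNReal.ofReal_rpow_of_pos (by positivity), ← Real.rpow_natCast, ← Real.rpow_mul (by norm_num),
    mul_comm, Real.rpow_mul (by norm_num), Real.inv_rpow (by norm_num), aux_two_rpow,
    Real.rpow_natCast, ENNReal.ofReal_pow (by norm_num), ENNReal.ofReal_inv_of_pos (by norm_num)]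
  simp

lemma aux_mass' (U : Set (ℝ × ℝ)) (hU : ediam U ≤ 1) :
    auxP (addr ⁻¹' U) ≤ 363 * ediam U ^ sdim := by
  have hs := aux_sdim_gt
  rcases eq_or_ne (ediam U) 0 with h0 | h0
  · have : ∀ n : ℕ, auxP (addr ⁻¹' U) ≤ 121 * (3:ℝ≥0∞)⁻¹ ^ n := fun n =>
      aux_mass U n (by rw [h0]; simp)
    have ht : Tendsto (fun n : ℕ => 121 * (3:ℝ≥0∞)⁻¹ ^ n) atTop (nhds (121 * 0)) :=
      ENNReal.Tendsto.const_mul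
        (ENNReal.tendsto_pow_atTop_nhds_zero_of_lt_one (by simp)) (Or.inr (by simp))
    have := ge_of_tendsto' ht this
    simp at this
    rw [this]; simp
  · have hfin : ediam U ≠ ⊤ := ne_top_of_le_ne_top (by simp) hU
    set d := (ediam U).toReal with hd
    have hdU : ediam U = ENNReal.ofReal d := (ENNReal.ofReal_toReal hfin).symm
    have hd0 : 0 < d := ENNReal.toReal_pos h0 hfin
    have hd1 : d ≤ 1 := by
      rw [hdU] at hU
      exact ENNReal.ofReal_le_one.mp hU
    obtain ⟨n, h1, h2⟩ := exists_nat_pow_near_of_lt_one hd0 hd1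
      (y := (2:ℝ)⁻¹) (by norm_num) (by norm_num)
    refine (aux_mass U n (by rw [hdU]; exact ENNReal.ofReal_le_ofReal h2)).trans ?_
    have : (3:ℝ≥0∞)⁻¹ ^ (n+1) ≤ ediam U ^ sdim := by
      rw [← aux_two_rpow', hdU]
      exact ENNReal.rpow_le_rpow (ENNReal.ofReal_le_ofReal h1.le) (by linarith)
    calc (121:ℝ≥0∞) * (3:ℝ≥0∞)⁻¹ ^ n = 363 * (3:ℝ≥0∞)⁻¹ ^ (n+1) := by
          rw [pow_succ', ← mul_assoc]
          congr 1
          rw [show (363:ℝ≥0∞) = 121 * 3 by norm_num, mul_assoc,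
            ENNReal.mul_inv_cancel (by simp) (by simp), mul_one]
      _ ≤ _ := by gcongr

lemma aux_SG_pos : 0 < μH[sdim] SG := by
  have hm : Measurable addr := aux_addr_continuous.measurable
  have key : (363:ℝ≥0∞)⁻¹ • Measure.map addr auxP ≤ μH[sdim] := by
    refine Measure.le_hausdorffMeasure sdim _ 1 one_pos (fun U hU => ?_)
    rw [Measure.smul_apply, smul_eq_mul]
    calc _ ≤ (363:ℝ≥0∞)⁻¹ * Measure.map addr auxP (closure U) := by
          gcongr; exact subset_closure
      _ = (363:ℝ≥0∞)⁻¹ * auxP (addr ⁻¹' closure U) := by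
          rw [Measure.map_apply hm isClosed_closure.measurableSet]
      _ ≤ (363:ℝ≥0∞)⁻¹ * (363 * ediam U ^ sdim) := by
          gcongr
          rw [← ediam_closure]
          exact aux_mass' _ (by rwa [ediam_closure])
      _ = _ := by
          rw [← mul_assoc, ENNReal.inv_mul_cancel (by simp) (by simp), one_mul]
  refine lt_of_lt_of_le ?_ (key SG)
  rw [Measure.smul_apply, Measure.map_apply hm aux_SG_compact.measurableSet, SG,
    Set.preimage_range, measure_univ]
  simp

lemma aux_lower (f : ℝ × ℝ → ℝ) : 0 < μH[sdim] (graphSG f) := by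
  have h := (LipschitzWith.prod_fst (α := ℝ × ℝ) (β := ℝ)).hausdorffMeasure_image_le
    (d := sdim) (by linarith [aux_sdim_gt]) (graphSG f)
  have e : Prod.fst '' graphSG f = SG := by
    rw [graphSG, Set.image_image]; simp
  rw [e] at h
  simp at h
  exact aux_SG_pos.trans_le h

lemma aux_uw_dist (w : List (Fin 3)) (x y : ℝ × ℝ) :
    dist (uw w x) (uw w y) = (2:ℝ)⁻¹ ^ w.length * dist x y := by
  induction w with
  | nil => simp [uw]
  | cons i w ih =>
    simp only [uw, Function.comp, u, List.length_cons, dist_smul₀, dist_add_right, ih, pow_succ']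
    simp [mul_assoc]

lemma aux_uw_SG (w : List (Fin 3)) (x : ℝ × ℝ) (hx : x ∈ SG) : uw w x ∈ SG := by
  induction w with
  | nil => simpa [uw]
  | cons i w ih =>
    obtain ⟨σ, hσ⟩ := ih
    refine ⟨fun n => Nat.casesOn n i σ, ?_⟩
    rw [aux_addr_shift]
    simp [uw, ← hσ]

lemma aux_addr_uw (n : ℕ) (σ : ℕ → Fin 3) :
    addr σ = uw (List.ofFn (fun k : Fin n => σ k)) (addr (fun k => σ (k+n))) := by
  induction n generalizing σ with
  | zero => simp [uw]
  | succ n ih =>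
    rw [List.ofFn_succ, aux_addr_shift, ih (fun k => σ (k+1))]
    simp only [uw, Function.comp, Fin.val_zero, Fin.val_succ]
    have : (fun k => σ (k + n + 1)) = fun k => σ (k + (n + 1)) := rfl
    rw [this]

lemma aux_cell_sub {n : ℕ} (w : Fin n → Fin 3) : cell w ⊆ SG := by
  rintro _ ⟨x, hx, rfl⟩
  exact aux_uw_SG _ _ hx

lemma aux_cell_dist {n : ℕ} (w : Fin n → Fin 3) {x y : ℝ × ℝ} (hx : x ∈ cell w) (hy : y ∈ cell w) :
    dist x y ≤ 2 * (2:ℝ)⁻¹ ^ n := by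
  obtain ⟨_, ⟨σ, rfl⟩, rfl⟩ := hx
  obtain ⟨_, ⟨τ, rfl⟩, rfl⟩ := hy
  rw [aux_uw_dist, List.length_ofFn, mul_comm]
  gcongr
  have := dist_le_norm_add_norm (addr σ) (addr τ)
  linarith [aux_norm_addr σ, aux_norm_addr τ]

lemma aux_graph_diam (f : ℝ × ℝ → ℝ) {n : ℕ} (w : Fin n → Fin 3) :
    ediam ((fun t => (t, f t)) '' cell w)
      ≤ max (ENNReal.ofReal (2 * (2:ℝ)⁻¹ ^ n)) (osc f (cell w)) := by
  refine ediam_le ?_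
  rintro _ ⟨x, hx, rfl⟩ _ ⟨y, hy, rfl⟩
  rw [Prod.edist_eq]
  refine max_le_max ?_ ?_
  · rw [edist_dist]
    exact ENNReal.ofReal_le_ofReal (aux_cell_dist w hx hy)
  · rw [edist_dist, Real.dist_eq]
    exact le_iSup₂_of_le x hx (le_iSup₂_of_le y hy le_rfl)

lemma aux_cover (f : ℝ × ℝ → ℝ) (n : ℕ) :
    graphSG f ⊆ ⋃ w : Fin n → Fin 3, (fun t => (t, f t)) '' cell w := by
  rintro _ ⟨_, ⟨σ, rfl⟩, rfl⟩
  rw [Set.mem_iUnion]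
  refine ⟨fun k => σ k, addr σ, ?_, rfl⟩
  exact ⟨_, ⟨_, rfl⟩, (aux_addr_uw n σ).symm⟩

lemma aux_osc_tendsto (f : ℝ × ℝ → ℝ) (hc : ContinuousOn f SG) :
    Tendsto (fun n : ℕ => ⨆ w : Fin n → Fin 3, osc f (cell w)) atTop (nhds 0) := by
  have huc := aux_SG_compact.uniformContinuousOn_of_continuous hc
  rw [Metric.uniformContinuousOn_iff_le] at huc
  rw [ENNReal.tendsto_nhds_zero]
  intro ε hε
  obtain ⟨r, hr0, hr⟩ : ∃ r : ℝ, 0 < r ∧ ENNReal.ofReal r ≤ ε := by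
    rcases eq_or_ne ε ⊤ with h | h
    · exact ⟨1, one_pos, by simp [h]⟩
    · exact ⟨ε.toReal, ENNReal.toReal_pos hε.ne' h, (ENNReal.ofReal_toReal h).le⟩
  obtain ⟨δ, hδ, H⟩ := huc r hr0
  have ht : Tendsto (fun n : ℕ => 2 * (2:ℝ)⁻¹ ^ n) atTop (nhds (2 * 0)) :=
    (_root_.tendsto_pow_atTop_nhds_zero_of_lt_one (by norm_num) (by norm_num)).const_mul 2
  rw [mul_zero] at ht
  filter_upwards [ht.eventually_le_const hδ] with n hn
  refine iSup_le fun w => iSup₂_le fun x hx => iSup₂_le fun y hy => ?_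
  refine le_trans (ENNReal.ofReal_le_ofReal ?_) hr
  rw [← Real.dist_eq]
  exact H x (aux_cell_sub w hx) y (aux_cell_sub w hy) ((aux_cell_dist w hx hy).trans hn)

lemma aux_oscS (f : ℝ × ℝ → ℝ) (n : ℕ) :
    ∑ w : Fin n → Fin 3, (osc f (cell w)) ^ sdim ≤ VA f * VA f ^ (sdim - 1) := by
  have hs := aux_sdim_gt
  have hsum : oscSum n f ≤ VA f := le_iSup (fun n => oscSum n f) n
  calc _ ≤ ∑ w : Fin n → Fin 3, osc f (cell w) * VA f ^ (sdim - 1) := by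
        refine Finset.sum_le_sum fun w _ => ?_
        have hw : osc f (cell w) ≤ VA f :=
          (Finset.single_le_sum (f := fun w : Fin n → Fin 3 => osc f (cell w))
            (fun _ _ => zero_le) (Finset.mem_univ w)).trans hsum
        have e : osc f (cell w) ^ sdim = osc f (cell w) * osc f (cell w) ^ (sdim - 1) := by
          conv_lhs => rw [show sdim = 1 + (sdim - 1) by ring,
            ENNReal.rpow_add_of_nonneg _ _ (by norm_num) (by linarith), ENNReal.rpow_one]
        rw [e]
        gcongr
    _ = oscSum n f * VA f ^ (sdim - 1) := by rw [oscSum, Finset.sum_mul]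
    _ ≤ _ := by gcongr

lemma aux_upper (f : ℝ × ℝ → ℝ) (hc : ContinuousOn f SG) (hbv : BVA f) :
    μH[sdim] (graphSG f) < ⊤ := by
  have hs := aux_sdim_gt
  have hr : Tendsto (fun n : ℕ => max (ENNReal.ofReal (2 * (2:ℝ)⁻¹ ^ n))
      (⨆ w : Fin n → Fin 3, osc f (cell w))) atTop (nhds 0) := by
    have ht : Tendsto (fun n : ℕ => 2 * (2:ℝ)⁻¹ ^ n) atTop (nhds (2 * 0)) :=
      (_root_.tendsto_pow_atTop_nhds_zero_of_lt_one (by norm_num) (by norm_num)).const_mul 2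
    have h1 := ENNReal.tendsto_ofReal ht
    simp only [mul_zero, ENNReal.ofReal_zero] at h1
    simpa using h1.max (aux_osc_tendsto f hc)
  have h := Measure.hausdorffMeasure_le_liminf_sum (ι := fun n : ℕ => (Fin n → Fin 3)) sdim
    (graphSG f) _ hr (fun n w => (fun t => (t, f t)) '' cell w)
    (Eventually.of_forall fun n w => (aux_graph_diam f w).trans
      (max_le_max le_rfl (le_iSup (fun w : Fin n → Fin 3 => osc f (cell w)) w)))
    (Eventually.of_forall fun n => aux_cover f n)
  have hb : ∀ n : ℕ, ∑ w : Fin n → Fin 3, ediam ((fun t => (t, f t)) '' cell w) ^ sdim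
      ≤ 3 + VA f * VA f ^ (sdim - 1) := by
    intro n
    calc _ ≤ ∑ w : Fin n → Fin 3, (3 * (3:ℝ≥0∞)⁻¹ ^ n + (osc f (cell w)) ^ sdim) := by
          refine Finset.sum_le_sum fun w _ => ?_
          refine (ENNReal.rpow_le_rpow (aux_graph_diam f w) (by linarith)).trans ?_
          have e : ENNReal.ofReal (2 * (2:ℝ)⁻¹ ^ n) ^ sdim = 3 * (3:ℝ≥0∞)⁻¹ ^ n := by
            rw [ENNReal.ofReal_mul (by norm_num), ENNReal.mul_rpow_of_nonneg _ _ (by linarith),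
              aux_two_rpow', ENNReal.ofReal_rpow_of_pos (by norm_num), aux_two_rpow]
            simp
          rw [← e]
          rcases max_choice (ENNReal.ofReal (2 * (2:ℝ)⁻¹ ^ n)) (osc f (cell w)) with h | h <;> rw [h]
          · exact le_self_add
          · exact le_add_self
      _ = 3 + ∑ w : Fin n → Fin 3, (osc f (cell w)) ^ sdim := by
          rw [Finset.sum_add_distrib]
          congr 1
          simp only [Finset.sum_const, Finset.card_univ, Fintype.card_fun, Fintype.card_fin,
            nsmul_eq_mul]
          push_cast
          rw [mul_left_comm, ← mul_pow, ENNReal.mul_inv_cancel (by simp) (by simp)]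
          simp
      _ ≤ _ := by gcongr; exact aux_oscS f n
  have hV : VA f ≠ ⊤ := ne_of_lt hbv
  have hfin : 3 + VA f * VA f ^ (sdim - 1) < ⊤ := by
    refine ENNReal.add_lt_top.mpr ⟨by simp, ENNReal.mul_lt_top hbv ?_⟩
    exact ENNReal.rpow_lt_top_of_nonneg (by linarith) hV
  refine lt_of_le_of_lt (h.trans ?_) hfin
  exact (liminf_le_liminf (Eventually.of_forall hb)).trans_eq (liminf_const _)

/-- for continuous `f` of bounded variation in sense (A),
`0 < H^s(G_f) < ∞` with `s = log 3 / log 2`; in particular `dim_H(G_f) = s`. -/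
theorem stmt19 (f : ℝ × ℝ → ℝ) (hc : ContinuousOn f SG) (hbv : BVA f) :
    0 < μH[sdim] (graphSG f) ∧ μH[sdim] (graphSG f) < ⊤ ∧
    dimH (graphSG f) = ENNReal.ofReal sdim := by 
  have h1 := aux_lower f
  have h2 := aux_upper f hc hbv
  refine ⟨h1, h2, ?_⟩
  have hs : ((sdim.toNNReal : NNReal) : ℝ) = sdim :=
    Real.coe_toNNReal _ (by linarith [aux_sdim_gt])
  exact dimH_of_hausdorffMeasure_ne_zero_ne_top (d := sdim.toNNReal)
    (by rw [hs]; exact h1.ne') (by rw [hs]; exact h2.ne)
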